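/- Let e : A → C be a canonical extension of a bounded lattice A, and let g : A → A satisfy g(a ⊓ b) = g(a) ⊓ g(b) for all a, b ∈ A. Let □g : A → A be the normalization of g, defined by □g(⊤) = ⊤ and □g(a) = g(a) for a ≠ ⊤. Then taking normalizations commutes with taking π-extensions: for every u ∈ C, (□g)^π(u) = ⊤ if u = ⊤, and (□g)^π(u) = g^π(u) if u ≠ ⊤; that is, (□g)^π equals the normalization of g^π. -/

import Mathlib

/-- `e : A → C` realizes the complete lattice `C` as a canonical extension of the
bounded lattice `A`. -/
structure IsCanonicalExtension {A C : Type*} [Lattice A] [BoundedOrder A]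
    [CompleteLattice C] (e : A → C) : Prop where
  injective : Function.Injective e
  map_inf : ∀ a b : A, e (a ⊓ b) = e a ⊓ e b
  map_sup : ∀ a b : A, e (a ⊔ b) = e a ⊔ e b
  map_bot : e ⊥ = ⊥
  map_top : e ⊤ = ⊤
  dense_sup : ∀ u : C, ∃ 𝒮 : Set (Set A), u = ⨆ S ∈ 𝒮, ⨅ a ∈ S, e a
  dense_inf : ∀ u : C, ∃ 𝒮 : Set (Set A), u = ⨅ S ∈ 𝒮, ⨆ a ∈ S, e a
  compact : ∀ S T : Set A, (⨆ a ∈ S, e a) ≤ (⨅ a ∈ T, e a) →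
      ∃ S' T' : Finset A, (S' : Set A) ⊆ S ∧ (T' : Set A) ⊆ T ∧
        (⨆ a ∈ S', e a) ≤ ⨅ a ∈ T', e a

/-- `k ∈ C` is a closed element (a meet of elements of the image of `e`). -/
def IsClosedElem {A C : Type*} [CompleteLattice C] (e : A → C) (k : C) : Prop :=
  ∃ S : Set A, k = ⨅ a ∈ S, e a

/-- `o ∈ C` is an open element (a join of elements of the image of `e`). -/
def IsOpenElem {A C : Type*} [CompleteLattice C] (e : A → C) (o : C) : Prop :=
  ∃ S : Set A, o = ⨆ a ∈ S, e a

/-- The π-extension of `h : A → A` to the canonical extension: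
`h^π(u) = ⨅ { ⨆ { e(h(a)) | a ∈ A, e(a) ≤ o } | o open, u ≤ o }`. -/
def piExt {A C : Type*} [CompleteLattice C] (e : A → C) (h : A → A) (u : C) : C :=
  ⨅ o ∈ {o : C | IsOpenElem e o ∧ u ≤ o}, ⨆ a ∈ {a : A | e a ≤ o}, e (h a)

/-- Every element other than `⊤` lies below an open element other than `⊤`. -/
theorem IsCanonicalExtension.exists_isOpenElem_ne_top {A C : Type*} [Lattice A]
    [BoundedOrder A] [CompleteLattice C] {e : A → C} (he : IsCanonicalExtension e)
    {u : C} (hu : u ≠ ⊤) : ∃ o : C, IsOpenElem e o ∧ u ≤ o ∧ o ≠ ⊤ := by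
  obtain ⟨𝒮, rfl⟩ := he.dense_inf u
  by_contra! h
  exact hu (iInf₂_eq_top.mpr fun S hS => h _ ⟨S, rfl⟩ (iInf₂_le S hS))

/-- Taking normalizations commutes with taking π-extensions: if `g` preserves
binary meets and `□g` is its normalization, then `(□g)^π` is the normalization of
`g^π`, i.e. `(□g)^π(⊤) = ⊤` and `(□g)^π(u) = g^π(u)` for `u ≠ ⊤`. -/
theorem piExt_normalization {A C : Type*} [Lattice A] [BoundedOrder A]
    [CompleteLattice C] (e : A → C) (he : IsCanonicalExtension e)
    (g Bg : A → A) (hg : ∀ a b : A, g (a ⊓ b) = g a ⊓ g b)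
    (hBg_top : Bg ⊤ = ⊤) (hBg : ∀ a : A, a ≠ ⊤ → Bg a = g a) :
    ∀ u : C, (u = ⊤ → piExt e Bg u = ⊤) ∧ (u ≠ ⊤ → piExt e Bg u = piExt e g u) := by
  have top_case : (⨆ a ∈ {a : A | e a ≤ ⊤}, e (Bg a)) = ⊤ := by
    refine top_le_iff.mp ?_
    calc (⊤ : C) = e (Bg ⊤) := by rw [hBg_top, he.map_top]
      _ ≤ _ := le_iSup₂_of_le (f := fun a (_ : a ∈ {a : A | e a ≤ ⊤}) => e (Bg a))
        ⊤ le_top le_rfl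
  have congr_of_ne : ∀ o : C, o ≠ ⊤ →
      (⨆ a ∈ {a : A | e a ≤ o}, e (Bg a)) = ⨆ a ∈ {a : A | e a ≤ o}, e (g a) := by
    refine fun o ho => biSup_congr fun a ha => congrArg e (hBg a ?_)
    rintro rfl
    exact ho (top_le_iff.mp (he.map_top ▸ ha))
  intro u
  refine ⟨?_, fun hu => le_antisymm ?_ ?_⟩
  · rintro rfl
    refine iInf₂_eq_top.mpr fun o ho => ?_
    obtain rfl := top_le_iff.mp ho.2
    exact top_case
  · refine le_iInf₂ fun o ho => ?_
    by_cases h : o = ⊤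
    · subst h
      obtain ⟨o, ho, huo, hne⟩ := he.exists_isOpenElem_ne_top hu
      refine (iInf₂_le o ⟨ho, huo⟩).trans ?_
      rw [congr_of_ne o hne]
      exact biSup_mono fun _ _ => le_top
    · exact (iInf₂_le o ho).trans (congr_of_ne o h).le
  · refine le_iInf₂ fun o ho => ?_
    by_cases h : o = ⊤
    · subst h
      exact top_case.symm ▸ le_top
    · exact (iInf₂_le o ho).trans (congr_of_ne o h).ge
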